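/- arXiv:2101.10229 — 2 statements merged into one kernel-verified Lean document; each statement's English description precedes it below -/
import Mathlib

section
/- Let m ≤ n be positive integers, T > 0, D ⊂ ℝ^n a compact set, and A ∈ ℝ^{m×n} with rank(A) = m. Suppose σ : ℝ → ℝ is locally Lipschitz continuous (for every R > 0 there exists L_R > 0 with |σ(s_1) − σ(s_2)| ≤ L_R|s_1 − s_2| for s_1, s_2 ∈ [−R, R]) and σ has the universal approximation property on D. Then for every continuous F : D → ℝ^m and every η > 0 there exist smooth functions α ∈ C^∞([0,T]; ℝ^m), β ∈ C^∞([0,T]; ℝ^{n×n}), and γ ∈ C^∞([0,T]; ℝ^n) such that for every ξ ∈ D, the solution (x, y) on [0,T] of the system x'(t) = β(t)x(t) + γ(t), y'(t) = α(t) ⊙ 𝛔(Ax(t)), x(0) = ξ, y(0) = 0 satisfies |y(T) − F(ξ)| < η. -/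
/-- Euclidean norm of a vector in ℝ^k. -/
noncomputable def euclNorm {k : ℕ} (v : Fin k → ℝ) : ℝ :=
  Real.sqrt (∑ i, (v i) ^ 2)

/-- σ is locally Lipschitz continuous. -/
def LocLip (σ : ℝ → ℝ) : Prop :=
  ∀ R > 0, ∃ LR > 0, ∀ s₁ ∈ Set.Icc (-R) R, ∀ s₂ ∈ Set.Icc (-R) R,
    |σ s₁ - σ s₂| ≤ LR * |s₁ - s₂|

/-- σ has the universal approximation property on a compact set D ⊂ ℝⁿ :
the linear span of ridge functions ξ ↦ σ(c·ξ + d) is dense in C(D) w.r.t. the sup norm. -/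
def HasUAP {n : ℕ} (σ : ℝ → ℝ) (D : Set (Fin n → ℝ)) : Prop :=
  ∀ F : (Fin n → ℝ) → ℝ, ContinuousOn F D → ∀ η > 0,
    ∃ (L : ℕ) (a d : Fin L → ℝ) (c : Fin L → Fin n → ℝ),
      ∀ ξ ∈ D, |(∑ l, a l * σ ((∑ i, c l i * ξ i) + d l)) - F ξ| < η

/-- The ridge function `p ↦ h p * g (c * u p + d)` along `u`, weighted by `h`. -/
def ridge {K : Type*} [TopologicalSpace K] (h u : C(K, ℝ)) (g : C(ℝ, ℝ)) (c d : ℝ) : C(K, ℝ) :=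
  ⟨fun p => h p * g (c * u p + d), by fun_prop⟩

theorem continuous_ridge {K : Type*} [TopologicalSpace K] (h u : C(K, ℝ)) (g : C(ℝ, ℝ)) :
    Continuous fun q : ℝ × ℝ => ridge h u g q.1 q.2 :=
  ContinuousMap.continuous_of_continuous_uncurry _ (by
    simp only [Function.uncurry_def, ridge, ContinuousMap.coe_mk]
    fun_prop)

section Ridge

variable {K : Type*} [TopologicalSpace K] [CompactSpace K]

theorem hasDerivAt_ridge (h u : C(K, ℝ)) (g g' : C(ℝ, ℝ)) (hg : ∀ t, HasDerivAt g (g' t) t)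
    (c d : ℝ) :
    HasDerivAt (fun s => ridge h u g s d) (ridge (h * u) u g' c d) c := by
  have hcont : Continuous fun s : ℝ => ridge (h * u) u g' s d :=
    (continuous_ridge (h * u) u g').comp (by fun_prop : Continuous fun s : ℝ => (s, d))
  have hint : ∀ s, ridge h u g s d =
      ridge h u g 0 d + ∫ r in (0 : ℝ)..s, ridge (h * u) u g' r d := by
    intro s
    ext p
    have hcomm := (ContinuousMap.evalCLM ℝ p : C(K, ℝ) →L[ℝ] ℝ).intervalIntegral_comp_comm
      (hcont.intervalIntegrable (μ := MeasureTheory.volume) 0 s)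
    have hftc : ∫ r in (0 : ℝ)..s, ridge (h * u) u g' r d p
        = ridge h u g s d p - ridge h u g 0 d p := by
      refine intervalIntegral.integral_eq_sub_of_hasDerivAt (f := fun r => ridge h u g r d p)
        (fun r _ => ?_) ?_
      · have h1 : HasDerivAt (fun r : ℝ => r * u p + d) (u p) r := by
          simpa using ((hasDerivAt_id r).mul_const (u p)).add_const d
        have h2 := ((hg (r * u p + d)).comp r h1).const_mul (h p)
        refine h2.congr_deriv ?_
        simp only [ridge, ContinuousMap.coe_mk, ContinuousMap.mul_apply]
        ring
      · exact Continuous.intervalIntegrable (by simp only [ridge, ContinuousMap.coe_mk]; fun_prop)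
          _ _
    simp only [ContinuousMap.evalCLM_apply] at hcomm
    rw [ContinuousMap.add_apply, ← hcomm, hftc]
    ring
  have := (intervalIntegral.integral_hasDerivAt_right
    (hcont.intervalIntegrable (μ := MeasureTheory.volume) 0 c)
    (hcont.stronglyMeasurableAtFilter _ _) hcont.continuousAt).const_add (ridge h u g 0 d)
  exact this.congr_of_eventuallyEq (Filter.Eventually.of_forall hint)

/-- A continuous functional killing all powers of `u` kills every function of `u`. -/
theorem functional_comp_eq_zero_of_pow (Λ : C(K, ℝ) →L[ℝ] ℝ) (u : C(K, ℝ))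
    (hpow : ∀ k : ℕ, Λ (u ^ k) = 0) (g : C(ℝ, ℝ)) : Λ (g.comp u) = 0 := by
  have hpoly : ∀ p : Polynomial ℝ, Λ (Polynomial.aeval u p) = 0 := by
    intro p
    rw [Polynomial.aeval_eq_sum_range, map_sum]
    exact Finset.sum_eq_zero fun k _ => by rw [map_smul, hpow, smul_zero]
  by_contra hne
  have hpos : 0 < |Λ (g.comp u)| := abs_pos.mpr hne
  set ε := |Λ (g.comp u)| / (2 * (‖Λ‖ + 1)) with hε
  have hΛ : 0 < ‖Λ‖ + 1 := by positivity
  have hεpos : 0 < ε := by positivity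
  obtain ⟨p, hp⟩ := exists_polynomial_near_of_continuousOn (-‖u‖) ‖u‖ g
    g.continuous.continuousOn ε hεpos
  have hnear : ‖Polynomial.aeval u p - g.comp u‖ ≤ ε := by
    refine (ContinuousMap.norm_le _ hεpos.le).mpr fun x => ?_
    have hx : u x ∈ Set.Icc (-‖u‖) ‖u‖ := abs_le.mp (u.norm_coe_le_norm x)
    have := hp _ hx
    simp only [ContinuousMap.sub_apply, Polynomial.aeval_continuousMap_apply,
      ContinuousMap.comp_apply, Real.norm_eq_abs]
    simpa [Polynomial.aeval_def] using this.le
  have h1 := Λ.le_opNorm (Polynomial.aeval u p - g.comp u)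
  rw [map_sub, hpoly, zero_sub, norm_neg, Real.norm_eq_abs] at h1
  have h2 : ‖Λ‖ * ‖Polynomial.aeval u p - g.comp u‖ ≤ (‖Λ‖ + 1) * ε := by
    gcongr
    linarith
  have h3 : (‖Λ‖ + 1) * ε = |Λ (g.comp u)| / 2 := by
    rw [hε]; field_simp
  linarith

/-- The `k`-th iterated derivative of a smooth function, as a continuous map. -/
noncomputable def iterDerivMap (τ : ℝ → ℝ) (hτ : ContDiff ℝ (⊤ : ℕ∞) τ) (k : ℕ) : C(ℝ, ℝ) :=
  ⟨iteratedDeriv k τ, hτ.continuous_iteratedDeriv k (by exact_mod_cast le_top)⟩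

theorem hasDerivAt_iterDerivMap (τ : ℝ → ℝ) (hτ : ContDiff ℝ (⊤ : ℕ∞) τ) (k : ℕ) (t : ℝ) :
    HasDerivAt (iterDerivMap τ hτ k) (iterDerivMap τ hτ (k + 1) t) t := by
  simp only [iterDerivMap, ContinuousMap.coe_mk, iteratedDeriv_succ]
  exact ((hτ.differentiable_iteratedDeriv k
    (by exact_mod_cast ENat.natCast_lt_top k)) t).hasDerivAt

theorem functional_ridge_eq_zero_of_contDiff (Λ : C(K, ℝ) →L[ℝ] ℝ) (u : C(K, ℝ)) (τ : ℝ → ℝ)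
    (hτ : ContDiff ℝ (⊤ : ℕ∞) τ)
    (h0 : ∀ c > 0, ∀ d, Λ (ridge 1 u ⟨τ, hτ.continuous⟩ c d) = 0) (c d : ℝ) :
    Λ (ridge 1 u ⟨τ, hτ.continuous⟩ c d) = 0 := by
  set G : ℕ → ℝ → ℝ → C(K, ℝ) := fun k => ridge (u ^ k) u (iterDerivMap τ hτ k) with hG
  have hG0 : ∀ c d, ridge 1 u ⟨τ, hτ.continuous⟩ c d = G 0 c d := by
    intro c d
    ext p
    simp [hG, ridge, iterDerivMap]
  have hder : ∀ k c d, HasDerivAt (fun s => Λ (G k s d)) (Λ (G (k + 1) c d)) c := fun k c d =>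
    Λ.hasFDerivAt.comp_hasDerivAt c
      (hasDerivAt_ridge (u ^ k) u _ _ (hasDerivAt_iterDerivMap τ hτ k) c d)
  have hright : ∀ k, ∀ c > 0, ∀ d, Λ (G k c d) = 0 := by
    intro k
    induction k with
    | zero => intro c hc d; rw [← hG0]; exact h0 c hc d
    | succ k ih =>
      intro c hc d
      refine (hder k c d).unique ((hasDerivAt_const c (0 : ℝ)).congr_of_eventuallyEq ?_)
      filter_upwards [lt_mem_nhds hc] with s hs using ih s hs d
  rw [hG0]
  by_cases hdeg : ∃ k, ∀ t, iteratedDeriv k τ t = 0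
  · obtain ⟨k, hk⟩ := hdeg
    have hdown : ∀ j ≤ k, ∀ c d, Λ (G j c d) = 0 := by
      intro j hj
      induction hj using Nat.decreasingInduction with
      | self =>
        intro c d
        have : G k c d = 0 := by
          ext p
          simp [hG, ridge, iterDerivMap, hk]
        rw [this, map_zero]
      | of_succ j _ ih =>
        intro c d
        have hconst := is_const_of_deriv_eq_zero (f := fun s => Λ (G j s d))
          (fun s => (hder j s d).differentiableAt) (fun s => by rw [(hder j s d).deriv, ih]) c 1
        exact hconst.trans (hright j 1 one_pos d)
    exact hdown 0 (Nat.zero_le k) c d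
  · push Not at hdeg
    have hpow : ∀ k, Λ (u ^ k) = 0 := by
      intro k
      obtain ⟨t, ht⟩ := hdeg k
      have hcont : Continuous fun s => Λ (G k s t) :=
        continuous_iff_continuousAt.mpr fun s => (hder k s t).continuousAt
      have hzero : Λ (G k 0 t) = 0 := by
        have hl : Filter.Tendsto (fun s => Λ (G k s t)) (nhdsWithin 0 (Set.Ioi 0))
            (nhds (Λ (G k 0 t))) := (hcont.tendsto 0).mono_left nhdsWithin_le_nhds
        refine tendsto_nhds_unique hl (tendsto_const_nhds.congr' ?_)
        filter_upwards [self_mem_nhdsWithin] with s hs using (hright k s hs t).symm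
      have heq : G k 0 t = iteratedDeriv k τ t • u ^ k := by
        ext p
        simp [hG, ridge, iterDerivMap, mul_comm]
      rw [heq, map_smul, smul_eq_mul] at hzero
      exact (mul_eq_zero.mp hzero).resolve_left ht
    have heq : G 0 c d = (⟨fun s => τ (c * s + d),
        hτ.continuous.comp (by fun_prop)⟩ : C(ℝ, ℝ)).comp u := by
      ext p
      simp [hG, ridge, iterDerivMap]
    rw [heq]
    exact functional_comp_eq_zero_of_pow Λ u hpow _

/-- If a continuous functional kills the ridge functions of all positive slopes along `u`, it kills
those of every slope. -/
theorem functional_ridge_eq_zero (Λ : C(K, ℝ) →L[ℝ] ℝ) (u : C(K, ℝ)) (g : C(ℝ, ℝ))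
    (h0 : ∀ c > 0, ∀ d, Λ (ridge 1 u g c d) = 0) (c d : ℝ) : Λ (ridge 1 u g c d) = 0 := by
  by_contra hne
  have hpos : 0 < |Λ (ridge 1 u g c d)| := abs_pos.mpr hne
  set ε := |Λ (ridge 1 u g c d)| / (2 * (‖Λ‖ + 1)) with hε
  have hΛ : 0 < ‖Λ‖ + 1 := by positivity
  have hεpos : 0 < ε := by positivity
  set R := |c| * ‖u‖ + |d| with hR
  have hunif := (isCompact_Icc (a := -(R + 1)) (b := R + 1)).uniformContinuousOn_of_continuous
    g.continuous.continuousOn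
  obtain ⟨δ, hδ, hunif⟩ := Metric.uniformContinuousOn_iff.mp hunif ε hεpos
  set r := min δ 1 with hr
  have hrpos : 0 < r := lt_min hδ one_pos
  let φ : ContDiffBump (0 : ℝ) := ⟨r / 2, r, by positivity, by linarith⟩
  let μ : MeasureTheory.Measure ℝ := MeasureTheory.volume
  set τ : ℝ → ℝ := MeasureTheory.convolution (φ.normed μ) g (ContinuousLinearMap.lsmul ℝ ℝ) μ
    with hτdef
  have hτ : ContDiff ℝ (⊤ : ℕ∞) τ :=
    φ.hasCompactSupport_normed.contDiff_convolution_left _ φ.contDiff_normed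
      g.continuous.locallyIntegrable
  have hφc : Continuous (φ.normed μ) := φ.contDiff_normed (n := 0).continuous
  have hcurve : ∀ c d, MeasureTheory.Integrable
      (fun s => φ.normed μ s • ridge 1 u g c (d - s)) μ := by
    intro c d
    refine Continuous.integrable_of_hasCompactSupport ?_ ?_
    · exact hφc.smul ((continuous_ridge 1 u g).comp
        (by fun_prop : Continuous fun s : ℝ => (c, d - s)))
    · exact φ.hasCompactSupport_normed.smul_right
  have hrep : ∀ c d, ridge 1 u ⟨τ, hτ.continuous⟩ c d
      = ∫ s, φ.normed μ s • ridge 1 u g c (d - s) ∂μ := by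
    intro c d
    ext p
    have := (ContinuousMap.evalCLM ℝ p : C(K, ℝ) →L[ℝ] ℝ).integral_comp_comm (hcurve c d)
    simp only [ContinuousMap.evalCLM_apply] at this
    rw [← this]
    simp [ridge, hτdef, MeasureTheory.convolution, add_sub_assoc]
  have hτ0 : Λ (ridge 1 u ⟨τ, hτ.continuous⟩ c d) = 0 := by
    refine functional_ridge_eq_zero_of_contDiff Λ u τ hτ (fun c hc d => ?_) c d
    rw [hrep, ← Λ.integral_comp_comm (hcurve c d)]
    simp [h0 c hc]
  have hnear : ‖ridge 1 u ⟨τ, hτ.continuous⟩ c d - ridge 1 u g c d‖ ≤ ε := by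
    refine (ContinuousMap.norm_le _ hεpos.le).mpr fun p => ?_
    have hbd : |c * u p + d| ≤ R := by
      refine (abs_add_le _ _).trans ?_
      rw [abs_mul]
      have := u.norm_coe_le_norm p
      rw [Real.norm_eq_abs] at this
      exact add_le_add (mul_le_mul_of_nonneg_left this (abs_nonneg c)) le_rfl
    have hmain := ContDiffBump.dist_normed_convolution_le (φ := φ) (μ := μ) (g := g)
      (x₀ := c * u p + d) (ε := ε) g.continuous.aestronglyMeasurable (fun x hx => by
        have hx' : dist x (c * u p + d) < r := hx
        have hx1 : |x - (c * u p + d)| < 1 := by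
          rw [← Real.dist_eq]; exact hx'.trans_le (min_le_right _ _)
        rw [abs_le] at hbd
        rw [abs_lt] at hx1
        refine (hunif x ⟨by linarith, by linarith⟩ _ ⟨by linarith, by linarith⟩
          (hx'.trans_le (min_le_left _ _))).le)
    simpa [ridge, dist_eq_norm] using hmain
  have h1 := Λ.le_opNorm (ridge 1 u ⟨τ, hτ.continuous⟩ c d - ridge 1 u g c d)
  rw [map_sub, hτ0, zero_sub, norm_neg, Real.norm_eq_abs] at h1
  have h2 : ‖Λ‖ * ‖ridge 1 u ⟨τ, hτ.continuous⟩ c d - ridge 1 u g c d‖ ≤ (‖Λ‖ + 1) * ε := by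
    gcongr
    linarith
  have h3 : (‖Λ‖ + 1) * ε = |Λ (ridge 1 u g c d)| / 2 := by
    rw [hε]; field_simp
  linarith

end Ridge

section Windows

/-- A smooth window: `1` on `[1/3, 2/3]`, `0` off `(0, 1)`. -/
noncomputable def window (u : ℝ) : ℝ :=
  Real.smoothTransition (3 * u) * Real.smoothTransition (3 - 3 * u)

/-- A smooth step from `0` to `1` taking place in `[1/3, 2/3]`. -/
noncomputable def windowStep (u : ℝ) : ℝ := Real.smoothTransition (3 * u - 1)

theorem contDiff_window : ContDiff ℝ (⊤ : ℕ∞) window := by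
  unfold window
  exact (Real.smoothTransition.contDiff.comp (by fun_prop)).mul
    (Real.smoothTransition.contDiff.comp (by fun_prop))

theorem contDiff_windowStep : ContDiff ℝ (⊤ : ℕ∞) windowStep :=
  Real.smoothTransition.contDiff.comp (by fun_prop)

theorem window_nonneg (u : ℝ) : 0 ≤ window u :=
  mul_nonneg (Real.smoothTransition.nonneg _) (Real.smoothTransition.nonneg _)

theorem window_le_one (u : ℝ) : window u ≤ 1 :=
  mul_le_one₀ (Real.smoothTransition.le_one _) (Real.smoothTransition.nonneg _)
    (Real.smoothTransition.le_one _)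

theorem window_of_nonpos {u : ℝ} (hu : u ≤ 0) : window u = 0 := by
  rw [window, Real.smoothTransition.zero_of_nonpos (by linarith), zero_mul]

theorem window_of_one_le {u : ℝ} (hu : 1 ≤ u) : window u = 0 := by
  rw [window, Real.smoothTransition.zero_of_nonpos (x := 3 - 3 * u) (by linarith), mul_zero]

theorem window_of_mem {u : ℝ} (h1 : 1 / 3 ≤ u) (h2 : u ≤ 2 / 3) : window u = 1 := by
  rw [window, Real.smoothTransition.one_of_one_le (by linarith),
    Real.smoothTransition.one_of_one_le (by linarith), one_mul]

theorem windowStep_of_le {u : ℝ} (hu : u ≤ 1 / 3) : windowStep u = 0 :=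
  Real.smoothTransition.zero_of_nonpos (by linarith)

theorem windowStep_of_ge {u : ℝ} (hu : 2 / 3 ≤ u) : windowStep u = 1 :=
  Real.smoothTransition.one_of_one_le (by linarith)

theorem mem_Icc_of_deriv_ne_zero {f : ℝ → ℝ} {a b v w t : ℝ} (hl : ∀ u < a, f u = v)
    (hr : ∀ u > b, f u = w) (ht : deriv f t ≠ 0) : t ∈ Set.Icc a b := by
  by_contra hmem
  rw [Set.mem_Icc, not_and_or, not_le, not_le] at hmem
  refine ht ?_
  rcases hmem with h | h
  · refine ((hasDerivAt_const t v).congr_of_eventuallyEq ?_).deriv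
    filter_upwards [gt_mem_nhds h] with u hu using hl u hu
  · refine ((hasDerivAt_const t w).congr_of_eventuallyEq ?_).deriv
    filter_upwards [lt_mem_nhds h] with u hu using hr u hu

/-- Finitely many smooth windows `ρ k` with disjoint supports in `[0, T]`, and smooth steps `ψ k`
from `0` to `1` that vary only where `ρ k = 1`. -/
theorem exists_windows (ι : Type*) [Fintype ι] {T : ℝ} (hT : 0 < T) :
    ∃ ρ ψ : ι → ℝ → ℝ,
      (∀ k, ContDiff ℝ (⊤ : ℕ∞) (ρ k)) ∧ (∀ k, ContDiff ℝ (⊤ : ℕ∞) (ψ k)) ∧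
      (∀ k t, 0 ≤ ρ k t) ∧ (∀ k t, ρ k t ≤ 1) ∧ (∀ k, ρ k 0 = 0) ∧
      (∀ k, ψ k 0 = 0) ∧ (∀ k, ψ k T = 1) ∧
      (∀ k t, deriv (ρ k) t ≠ 0 → ∀ j ≠ k, ρ j t = 0) ∧
      (∀ k t, deriv (ψ k) t ≠ 0 → ρ k t = 1 ∧ ∀ j ≠ k, ρ j t = 0) := by
  let e := Fintype.equivFin ι
  let N : ℝ := (Fintype.card ι : ℕ)
  let u : ι → ℝ → ℝ := fun k t => N / T * t + -((e k : ℕ) : ℝ)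
  have hu : ∀ k, ContDiff ℝ (⊤ : ℕ∞) (u k) := fun k => by fun_prop
  have hchain : ∀ (f : ℝ → ℝ), ContDiff ℝ (⊤ : ℕ∞) f → ∀ k t,
      deriv (fun s => f (u k s)) t ≠ 0 → deriv f (u k t) ≠ 0 := by
    intro f hf k t ht h0
    have h1 : HasDerivAt (u k) (N / T) t := by
      exact (((hasDerivAt_id t).const_mul (N / T)).add_const (-((e k : ℕ) : ℝ))).congr_deriv
        (mul_one _)
    have h2 := ((hf.differentiable (by simp)) (u k t)).hasDerivAt.comp t h1
    rw [h0, zero_mul] at h2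
    exact ht h2.deriv
  have hdisj : ∀ k t, u k t ∈ Set.Icc (0 : ℝ) 1 → ∀ j ≠ k, window (u j t) = 0 := by
    intro k t ht j hj
    have hne : (e j : ℕ) ≠ (e k : ℕ) := fun h => hj (e.injective (Fin.ext h))
    have hshift : u j t = u k t + (e k : ℕ) - (e j : ℕ) := by simp only [u]; ring
    rcases lt_or_gt_of_ne hne with h | h
    · have : ((e j : ℕ) : ℝ) + 1 ≤ (e k : ℕ) := by exact_mod_cast h
      exact window_of_one_le (by linarith [ht.1])
    · have : ((e k : ℕ) : ℝ) + 1 ≤ (e j : ℕ) := by exact_mod_cast h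
      exact window_of_nonpos (by linarith [ht.2])
  have hu0 : ∀ k, u k 0 ≤ 0 := fun k => by simp [u]
  have huT : ∀ k, 1 ≤ u k T := fun k => by
    have : ((e k : ℕ) : ℝ) + 1 ≤ (Fintype.card ι : ℕ) := by
      exact_mod_cast (e k).isLt
    simp only [u, N, div_mul_cancel₀ _ hT.ne']
    linarith
  refine ⟨fun k t => window (u k t), fun k t => windowStep (u k t),
    fun k => contDiff_window.comp (hu k), fun k => contDiff_windowStep.comp (hu k),
    fun k t => window_nonneg _, fun k t => window_le_one _, fun k => window_of_nonpos (hu0 k),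
    fun k => windowStep_of_le (by linarith [hu0 k]),
    fun k => windowStep_of_ge (by linarith [huT k]), fun k t ht => ?_, fun k t ht => ?_⟩
  · exact hdisj k t (mem_Icc_of_deriv_ne_zero (fun u hu => window_of_nonpos hu.le)
      (fun u hu => window_of_one_le hu.le) (hchain _ contDiff_window k t ht))
  · have hmem := mem_Icc_of_deriv_ne_zero (a := 1 / 3) (b := 2 / 3)
      (fun u hu => windowStep_of_le hu.le)
      (fun u hu => windowStep_of_ge hu.le) (hchain _ contDiff_windowStep k t ht)
    exact ⟨window_of_mem hmem.1 hmem.2,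
      hdisj k t ⟨by linarith [hmem.1], by linarith [hmem.2]⟩⟩

end Windows

section Control

theorem linear_ode_unique {n : ℕ} {T : ℝ} {β : ℝ → Fin n → Fin n → ℝ} {γ : ℝ → Fin n → ℝ}
    (hβ : ContinuousOn β (Set.Icc 0 T)) {x z : ℝ → Fin n → ℝ} (h0 : x 0 = z 0)
    (hx : ∀ t ∈ Set.Icc (0 : ℝ) T, HasDerivWithinAt x
      (fun i => (∑ j, β t i j * x t j) + γ t i) (Set.Icc 0 T) t)
    (hz : ∀ t ∈ Set.Icc (0 : ℝ) T, HasDerivWithinAt z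
      (fun i => (∑ j, β t i j * z t j) + γ t i) (Set.Icc 0 T) t) :
    ∀ t ∈ Set.Icc (0 : ℝ) T, x t = z t := by
  obtain ⟨C, hC⟩ := isCompact_Icc.exists_bound_of_continuousOn hβ
  have hd : ∀ t ∈ Set.Icc (0 : ℝ) T, HasDerivWithinAt (x - z)
      (fun i => ∑ j, β t i j * (x - z) t j) (Set.Icc 0 T) t := by
    intro t ht
    refine ((hx t ht).sub (hz t ht)).congr_deriv ?_
    ext i
    simp only [Pi.sub_apply, mul_sub, Finset.sum_sub_distrib]
    ring
  have key := eq_zero_of_abs_deriv_le_mul_abs_self_of_eq_zero_right (f := x - z)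
    (f' := fun t i => ∑ j, β t i j * (x - z) t j) (K := n * C) (a := 0) (b := T)
    (fun t ht => (hd t ht).continuousWithinAt)
    (fun t ht => (hd t ⟨ht.1, ht.2.le⟩).mono_of_mem_nhdsWithin (Icc_mem_nhdsGE_of_mem ht))
    (by simp [h0])
    (fun t ht => by
      have hCt := hC t ⟨ht.1, ht.2.le⟩
      have hC0 : 0 ≤ C := (norm_nonneg _).trans hCt
      refine (pi_norm_le_iff_of_nonneg (by positivity)).mpr fun i => ?_
      refine (norm_sum_le _ _).trans ?_
      calc ∑ j, ‖β t i j * (x - z) t j‖ ≤ ∑ _j : Fin n, C * ‖(x - z) t‖ := by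
            refine Finset.sum_le_sum fun j _ => ?_
            rw [norm_mul]
            exact mul_le_mul (((norm_le_pi_norm _ j).trans (norm_le_pi_norm _ i)).trans hCt)
              (norm_le_pi_norm _ j) (norm_nonneg _) hC0
        _ = n * C * ‖(x - z) t‖ := by simp [mul_assoc])
  intro t ht
  exact sub_eq_zero.mp (key t ht)

/-- Every finite combination of ridge functions whose slopes have positive inner product with the
corresponding rows of `A` is realized exactly at time `T`. -/
theorem exists_control {m n : ℕ} {T : ℝ} (hT : 0 < T) (A : Matrix (Fin m) (Fin n) ℝ) (σ : ℝ → ℝ)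
    {ι : Type*} [Fintype ι] (r : ι → Fin m) (a d : ι → ℝ) (c : ι → Fin n → ℝ)
    (hc : ∀ k, 0 < c k ⬝ᵥ A (r k)) :
    ∃ (α : ℝ → Fin m → ℝ) (β : ℝ → Fin n → Fin n → ℝ) (γ : ℝ → Fin n → ℝ),
      ContDiff ℝ (⊤ : ℕ∞) α ∧ ContDiff ℝ (⊤ : ℕ∞) β ∧ ContDiff ℝ (⊤ : ℕ∞) γ ∧
      ∀ (x : ℝ → Fin n → ℝ) (y : ℝ → Fin m → ℝ), y 0 = 0 →
        (∀ t ∈ Set.Icc (0 : ℝ) T, HasDerivWithinAt x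
          (fun i => (∑ j, β t i j * x t j) + γ t i) (Set.Icc 0 T) t) →
        (∀ t ∈ Set.Icc (0 : ℝ) T, HasDerivWithinAt y
          (fun i => α t i * σ (A.mulVec (x t) i)) (Set.Icc 0 T) t) →
        ∀ i, y T i = ∑ k, if r k = i then a k * σ (c k ⬝ᵥ x 0 + d k) else 0 := by
  classical
  obtain ⟨ρ, ψ, hρ, hψ, hρ0, hρ1, hρz, hψ0, hψT, hρd, hψd⟩ := exists_windows ι hT
  have hrow : ∀ k, 0 < A (r k) ⬝ᵥ A (r k) := by
    intro k
    have h0 : 0 ≤ A (r k) ⬝ᵥ A (r k) := Finset.sum_nonneg fun i _ => mul_self_nonneg _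
    refine h0.lt_of_ne' fun h => ?_
    have := hc k
    rw [dotProduct_self_eq_zero.mp h, dotProduct_zero] at this
    exact this.false
  let v : ι → Fin n → ℝ := fun k => (A (r k) ⬝ᵥ A (r k))⁻¹ • A (r k)
  let b : ι → Fin n → ℝ := fun k => c k - A (r k)
  have hv : ∀ k, A (r k) ⬝ᵥ v k = 1 := fun k => by
    simp only [v, dotProduct_smul, smul_eq_mul]
    exact inv_mul_cancel₀ (hrow k).ne'
  have hbv : ∀ k, -1 < b k ⬝ᵥ v k := fun k => by
    have : 0 < c k ⬝ᵥ v k := by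
      simp only [v, dotProduct_smul, smul_eq_mul]
      exact mul_pos (inv_pos.mpr (hrow k)) (hc k)
    simp only [b, sub_dotProduct, hv]
    linarith
  have hden : ∀ k t, 0 < 1 + ρ k t * (b k ⬝ᵥ v k) := fun k t => by
    rcases le_or_gt 0 (b k ⬝ᵥ v k) with h | h
    · linarith [mul_nonneg (hρ0 k t) h]
    · nlinarith [hρ1 k t, hbv k]
  have hdρ : ∀ k, ContDiff ℝ (⊤ : ℕ∞) (deriv (ρ k)) := fun k =>
    (contDiff_infty_iff_deriv.mp (hρ k)).2
  have hdψ : ∀ k, ContDiff ℝ (⊤ : ℕ∞) (deriv (ψ k)) := fun k =>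
    (contDiff_infty_iff_deriv.mp (hψ k)).2
  let θ : ι → ℝ → ℝ := fun k t => deriv (ρ k) t / (1 + ρ k t * (b k ⬝ᵥ v k))
  have hθ : ∀ k, ContDiff ℝ (⊤ : ℕ∞) (θ k) := fun k =>
    (hdρ k).div (contDiff_const.add ((hρ k).mul contDiff_const)) fun t => (hden k t).ne'
  let α : ℝ → Fin m → ℝ := fun t i => ∑ k, if r k = i then a k * deriv (ψ k) t else 0
  let β : ℝ → Fin n → Fin n → ℝ := fun t i j => ∑ k, θ k t * (v k i * b k j)
  let γ : ℝ → Fin n → ℝ := fun t i => ∑ k, θ k t * (d k * v k i)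
  have hα : ContDiff ℝ (⊤ : ℕ∞) α := by
    refine contDiff_pi.mpr fun i => ContDiff.sum fun k _ => ?_
    split_ifs
    · exact contDiff_const.mul (hdψ k)
    · exact contDiff_const
  have hβ : ContDiff ℝ (⊤ : ℕ∞) β :=
    contDiff_pi.mpr fun i => contDiff_pi.mpr fun j => ContDiff.sum fun k _ =>
      (hθ k).mul contDiff_const
  have hγ : ContDiff ℝ (⊤ : ℕ∞) γ :=
    contDiff_pi.mpr fun i => ContDiff.sum fun k _ => (hθ k).mul contDiff_const
  refine ⟨α, β, γ, hα, hβ, hγ, fun x y hy0 hx hy i => ?_⟩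
  set ξ := x 0 with hξ
  let X : ℝ → Fin n → ℝ := fun t i => ξ i + ∑ k, ρ k t * ((b k ⬝ᵥ ξ + d k) * v k i)
  have hXk : ∀ k t, (∀ j ≠ k, ρ j t = 0) → X t = ξ + (ρ k t * (b k ⬝ᵥ ξ + d k)) • v k := by
    intro k t h
    ext i
    simp only [X, Pi.add_apply, Pi.smul_apply, smul_eq_mul]
    rw [Finset.sum_eq_single k (fun j _ hj => by rw [h j hj, zero_mul]) (by simp)]
    ring
  have hX : ∀ t, HasDerivAt X (fun i => (∑ j, β t i j * X t j) + γ t i) t := by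
    intro t
    refine hasDerivAt_pi.mpr fun i => ?_
    have h1 : HasDerivAt (fun t => X t i) (∑ k, deriv (ρ k) t * ((b k ⬝ᵥ ξ + d k) * v k i)) t :=
      (HasDerivAt.fun_sum fun k _ =>
        (((hρ k).differentiable (by simp) t).hasDerivAt.mul_const _)).const_add (ξ i)
    refine h1.congr_deriv ?_
    have h2 : (∑ j, β t i j * X t j) + γ t i = ∑ k, θ k t * ((b k ⬝ᵥ X t + d k) * v k i) := by
      simp only [β, γ, Finset.sum_mul]
      rw [Finset.sum_comm, ← Finset.sum_add_distrib]
      refine Finset.sum_congr rfl fun k _ => ?_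
      simp only [dotProduct, add_mul, mul_add, Finset.sum_mul, Finset.mul_sum]
      congr 1
      exact Finset.sum_congr rfl fun j _ => by ring
    rw [h2]
    refine Finset.sum_congr rfl fun k _ => ?_
    by_cases hk : deriv (ρ k) t = 0
    · simp [θ, hk]
    · rw [hXk k t (hρd k t hk), dotProduct_add, dotProduct_smul, smul_eq_mul]
      have := (hden k t).ne'
      simp only [θ]
      field_simp
      ring
  have hxX := linear_ode_unique (hβ.continuous.continuousOn) (by simp [X, hρz, hξ]) hx
    fun t _ => (hX t).hasDerivWithinAt
  let Y : ℝ → ℝ := fun t => ∑ k, if r k = i then a k * σ (c k ⬝ᵥ ξ + d k) * ψ k t else 0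
  have hY : ∀ t ∈ Set.Icc 0 T, HasDerivAt Y (α t i * σ (A.mulVec (x t) i)) t := by
    intro t ht
    have h1 : HasDerivAt Y
        (∑ k, if r k = i then a k * σ (c k ⬝ᵥ ξ + d k) * deriv (ψ k) t else 0) t := by
      refine HasDerivAt.fun_sum fun k _ => ?_
      split_ifs
      · exact ((hψ k).differentiable (by simp) t).hasDerivAt.const_mul _
      · exact hasDerivAt_const _ _
    refine h1.congr_deriv ?_
    simp only [α, Finset.sum_mul]
    refine Finset.sum_congr rfl fun k _ => ?_
    split_ifs with hi
    · by_cases hk : deriv (ψ k) t = 0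
      · simp [hk]
      · obtain ⟨hone, hoff⟩ := hψd k t hk
        have : A.mulVec (x t) i = c k ⬝ᵥ ξ + d k := by
          rw [hxX t ht, hXk k t hoff, hone, ← hi]
          change A (r k) ⬝ᵥ _ = _
          rw [dotProduct_add, dotProduct_smul, hv]
          simp only [b, sub_dotProduct, smul_eq_mul]
          ring
        rw [this]
        ring
    · simp
  have hdiff : ∀ t ∈ Set.Icc 0 T, HasDerivWithinAt (fun t => y t i - Y t) 0 (Set.Icc 0 T) t := by
    intro t ht
    exact ((hasDerivWithinAt_pi.mp (hy t ht) i).sub (hY t ht).hasDerivWithinAt).congr_deriv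
      (sub_self _)
  have hconst := constant_of_has_deriv_right_zero
    (fun t ht => (hdiff t ht).continuousWithinAt)
    (fun t ht => (hdiff t ⟨ht.1, ht.2.le⟩).mono_of_mem_nhdsWithin (Icc_mem_nhdsGE_of_mem ht))
    T ⟨hT.le, le_rfl⟩
  have hYT : Y T = ∑ k, if r k = i then a k * σ (c k ⬝ᵥ ξ + d k) else 0 := by
    simp [Y, hψT]
  have hY0 : Y 0 = 0 := by simp [Y, hψ0]
  simp only [hY0, hy0, Pi.zero_apply, sub_zero] at hconst
  rw [← hYT]
  linarith

end Control

section Density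

/-- A continuous linear functional separates a point from a closed subspace not containing it. -/
theorem exists_functional_of_notMem {E : Type*} [NormedAddCommGroup E] [NormedSpace ℝ E]
    {V : Submodule ℝ E} (hV : IsClosed (V : Set E)) {x : E} (hx : x ∉ V) :
    ∃ Λ : E →L[ℝ] ℝ, Λ x ≠ 0 ∧ ∀ y ∈ V, Λ y = 0 := by
  obtain ⟨Λ, s, hxs, hs⟩ := geometric_hahn_banach_point_closed V.convex hV hx
  have hzero : ∀ y ∈ V, Λ y = 0 := by
    intro y hy
    by_contra hne
    have := hs (((s - 1) / Λ y) • y) (V.smul_mem _ hy)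
    rw [map_smul, smul_eq_mul, div_mul_cancel₀ _ hne] at this
    linarith
  have h0 := hs 0 V.zero_mem
  rw [map_zero] at h0
  exact ⟨Λ, (hxs.trans h0).ne, hzero⟩

theorem LocLip.continuous {σ : ℝ → ℝ} (hσ : LocLip σ) : Continuous σ := by
  refine continuous_iff_continuousAt.mpr fun s => ?_
  obtain ⟨L, hL, h⟩ := hσ (|s| + 1) (by positivity)
  have hlip : LipschitzOnWith L.toNNReal σ (Set.Icc (-(|s| + 1)) (|s| + 1)) := by
    refine LipschitzOnWith.of_dist_le_mul fun p hp q hq => ?_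
    rw [Real.coe_toNNReal L hL.le]
    exact h p hp q hq
  exact hlip.continuousOn.continuousAt
    (Icc_mem_nhds (by linarith [neg_abs_le s]) (by linarith [le_abs_self s]))

/-- The ridge function `ξ ↦ g (c ⬝ᵥ ξ + d)` on `D`. -/
def ridgeOn {n : ℕ} (D : Set (Fin n → ℝ)) (g : C(ℝ, ℝ)) (c : Fin n → ℝ) (d : ℝ) : C(D, ℝ) :=
  ⟨fun ξ => g (c ⬝ᵥ ξ.1 + d), by
    have : Continuous fun ξ : D => c ⬝ᵥ ξ.1 := continuous_const.dotProduct continuous_subtype_val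
    fun_prop⟩

theorem continuous_ridgeOn {n : ℕ} (D : Set (Fin n → ℝ)) (g : C(ℝ, ℝ)) (d : ℝ) :
    Continuous fun c => ridgeOn D g c d :=
  ContinuousMap.continuous_of_continuous_uncurry _ (by
    have : Continuous fun q : (Fin n → ℝ) × D => q.1 ⬝ᵥ q.2.1 :=
      continuous_fst.dotProduct (continuous_subtype_val.comp continuous_snd)
    simp only [Function.uncurry_def, ridgeOn, ContinuousMap.coe_mk]
    fun_prop)

/-- A continuous functional killing the ridge functions with slopes in an open half-space kills all
ridge functions. -/
theorem functional_ridgeOn_eq_zero {n : ℕ} {D : Set (Fin n → ℝ)} [CompactSpace D] (g : C(ℝ, ℝ))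
    {w : Fin n → ℝ} (hw : w ≠ 0) (Λ : C(D, ℝ) →L[ℝ] ℝ)
    (h0 : ∀ c d, 0 < c ⬝ᵥ w → Λ (ridgeOn D g c d) = 0) (c : Fin n → ℝ) (d : ℝ) :
    Λ (ridgeOn D g c d) = 0 := by
  let u : (Fin n → ℝ) → C(D, ℝ) := fun c =>
    ⟨fun ξ => c ⬝ᵥ ξ.1, continuous_const.dotProduct continuous_subtype_val⟩
  have hridge : ∀ c (s d : ℝ), ridge 1 (u c) g s d = ridgeOn D g (s • c) d := by
    intro c s d
    ext ξ
    simp [ridge, ridgeOn, u]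
  have hhalf : ∀ c, 0 < c ⬝ᵥ w → ∀ s d : ℝ, Λ (ridgeOn D g (s • c) d) = 0 := by
    intro c hc s d
    rw [← hridge]
    refine functional_ridge_eq_zero Λ (u c) g (fun s hs d => ?_) s d
    rw [hridge]
    exact h0 _ _ (by rw [smul_dotProduct]; exact mul_pos hs hc)
  rcases lt_trichotomy (c ⬝ᵥ w) 0 with hc | hc | hc
  · simpa using hhalf (-c) (by rw [neg_dotProduct]; linarith) (-1) d
  · have hww : 0 < w ⬝ᵥ w :=
      (Finset.sum_nonneg fun i _ => mul_self_nonneg (w i)).lt_of_ne'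
        fun h => hw (dotProduct_self_eq_zero.mp h)
    have hcont : Continuous fun ε : ℝ => Λ (ridgeOn D g (c + ε • w) d) :=
      Λ.continuous.comp ((continuous_ridgeOn D g d).comp (by fun_prop))
    have hlim : Filter.Tendsto (fun ε : ℝ => Λ (ridgeOn D g (c + ε • w) d))
        (nhdsWithin 0 (Set.Ioi 0)) (nhds (Λ (ridgeOn D g c d))) := by
      simpa using (hcont.tendsto 0).mono_left nhdsWithin_le_nhds
    refine tendsto_nhds_unique hlim (tendsto_const_nhds.congr' ?_)
    filter_upwards [self_mem_nhdsWithin] with ε hε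
    refine (h0 _ _ ?_).symm
    rw [add_dotProduct, smul_dotProduct, hc, zero_add]
    exact mul_pos hε hww
  · exact h0 c d hc

/-- The universal approximation property persists when the slopes are restricted to an open
half-space. -/
theorem HasUAP.exists_halfspace {n : ℕ} {σ : ℝ → ℝ} {D : Set (Fin n → ℝ)} (huap : HasUAP σ D)
    (hD : IsCompact D) (hσ : Continuous σ) {w : Fin n → ℝ} (hw : w ≠ 0) {f : (Fin n → ℝ) → ℝ}
    (hf : ContinuousOn f D) {ε : ℝ} (hε : 0 < ε) :
    ∃ (L : ℕ) (a d : Fin L → ℝ) (c : Fin L → Fin n → ℝ), (∀ l, 0 < c l ⬝ᵥ w) ∧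
      ∀ ξ ∈ D, |(∑ l, a l * σ (c l ⬝ᵥ ξ + d l)) - f ξ| < ε := by
  have := isCompact_iff_compactSpace.mp hD
  let g : C(ℝ, ℝ) := ⟨σ, hσ⟩
  let f' : C(D, ℝ) := ⟨D.domRestrict f, hf.domRestrict⟩
  let S : Set C(D, ℝ) := {h | ∃ c d, 0 < c ⬝ᵥ w ∧ ridgeOn D g c d = h}
  have hmem : f' ∈ (Submodule.span ℝ S).topologicalClosure := by
    by_contra hnot
    obtain ⟨Λ, hΛf, hΛ⟩ := exists_functional_of_notMem
      (Submodule.isClosed_topologicalClosure _) hnot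
    have hall := functional_ridgeOn_eq_zero g hw Λ fun c d hc =>
      hΛ _ (Submodule.le_topologicalClosure _ (Submodule.subset_span ⟨c, d, hc, rfl⟩))
    have hpos : 0 < |Λ f'| := abs_pos.mpr hΛf
    set δ := |Λ f'| / (2 * (‖Λ‖ + 1)) with hδ
    have hΛpos : 0 < ‖Λ‖ + 1 := by positivity
    have hδpos : 0 < δ := by positivity
    obtain ⟨L, a, d, c, happ⟩ := huap f hf δ hδpos
    have hnear : ‖∑ l, a l • ridgeOn D g (c l) (d l) - f'‖ ≤ δ := by
      refine (ContinuousMap.norm_le _ hδpos.le).mpr fun ξ => ?_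
      simpa [ridgeOn, dotProduct, g, f'] using (happ ξ.1 ξ.2).le
    have h1 := Λ.le_opNorm (∑ l, a l • ridgeOn D g (c l) (d l) - f')
    have h2 : Λ (∑ l, a l • ridgeOn D g (c l) (d l)) = 0 := by simp [hall]
    rw [map_sub, h2, zero_sub, norm_neg, Real.norm_eq_abs] at h1
    have h3 : ‖Λ‖ * ‖∑ l, a l • ridgeOn D g (c l) (d l) - f'‖ ≤ (‖Λ‖ + 1) * δ := by
      gcongr
      linarith
    have h4 : (‖Λ‖ + 1) * δ = |Λ f'| / 2 := by
      rw [hδ]; field_simp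
    linarith
  obtain ⟨h, hh, hdist⟩ := Metric.mem_closure_iff.mp hmem ε hε
  obtain ⟨L, a, s, rfl⟩ := Submodule.mem_span_set'.mp hh
  choose c d hc hs using fun l => (s l).2
  refine ⟨L, a, d, c, hc, fun ξ hξ => ?_⟩
  rw [dist_comm, dist_eq_norm] at hdist
  refine lt_of_le_of_lt ?_ hdist
  have := (∑ l, a l • (s l : C(D, ℝ)) - f').norm_coe_le_norm ⟨ξ, hξ⟩
  simpa [← hs, ridgeOn, g, f'] using this

theorem euclNorm_le_sum_abs {k : ℕ} (v : Fin k → ℝ) : euclNorm v ≤ ∑ i, |v i| := by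
  refine Real.sqrt_le_iff.mpr ⟨Finset.sum_nonneg fun i _ => abs_nonneg _, ?_⟩
  simpa using Finset.sum_sq_le_sq_sum_of_nonneg (s := Finset.univ) fun i _ => abs_nonneg (v i)

theorem row_ne_zero_of_rank_eq {m n : ℕ} {A : Matrix (Fin m) (Fin n) ℝ} (hA : A.rank = m)
    (i : Fin m) : A i ≠ 0 := by
  have hli : LinearIndependent ℝ A.row := by
    rw [linearIndependent_iff_card_eq_finrank_span, Set.finrank,
      ← Matrix.rank_eq_finrank_span_row, hA,
      Fintype.card_fin]
  exact hli.ne_zero i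

end Density

/-- Theorem: universal approximation property for ODENet. -/
theorem stmt_4 (m n : ℕ) (hm : 0 < m) (hmn : m ≤ n) (T : ℝ) (hT : 0 < T)
    (D : Set (Fin n → ℝ)) (hD : IsCompact D)
    (A : Matrix (Fin m) (Fin n) ℝ) (hA : A.rank = m)
    (σ : ℝ → ℝ) (hσ : LocLip σ) (huap : HasUAP σ D)
    (F : (Fin n → ℝ) → Fin m → ℝ) (hF : ContinuousOn F D)
    (η : ℝ) (hη : 0 < η) :
    ∃ (α : ℝ → Fin m → ℝ) (β : ℝ → Fin n → Fin n → ℝ) (γ : ℝ → Fin n → ℝ),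
      ContDiffOn ℝ (⊤ : ℕ∞) α (Set.Icc 0 T) ∧
      ContDiffOn ℝ (⊤ : ℕ∞) β (Set.Icc 0 T) ∧
      ContDiffOn ℝ (⊤ : ℕ∞) γ (Set.Icc 0 T) ∧
      ∀ ξ ∈ D, ∀ (x : ℝ → Fin n → ℝ) (y : ℝ → Fin m → ℝ),
        x 0 = ξ → y 0 = 0 →
        (∀ t ∈ Set.Icc (0 : ℝ) T, HasDerivWithinAt x
          (fun i => (∑ j, β t i j * x t j) + γ t i) (Set.Icc 0 T) t) →
        (∀ t ∈ Set.Icc (0 : ℝ) T, HasDerivWithinAt y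
          (fun i => α t i * σ (A.mulVec (x t) i)) (Set.Icc 0 T) t) →
        euclNorm (y T - F ξ) < η := by
  have hε : 0 < η / m := div_pos hη (Nat.cast_pos.mpr hm)
  choose L a d c hc happ using fun i : Fin m =>
    huap.exists_halfspace hD hσ.continuous (row_ne_zero_of_rank_eq hA i)
      ((continuous_apply i).comp_continuousOn hF) hε
  obtain ⟨α, β, γ, hα, hβ, hγ, hsol⟩ := exists_control hT A σ
    (ι := Σ i, Fin (L i)) (fun k => k.1) (fun k => a k.1 k.2) (fun k => d k.1 k.2)
    (fun k => c k.1 k.2) (fun k => hc k.1 k.2)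
  refine ⟨α, β, γ, hα.contDiffOn, hβ.contDiffOn, hγ.contDiffOn,
    fun ξ hξ x y hx0 hy0 hx hy => ?_⟩
  have hy_T : ∀ i, y T i = ∑ l, a i l * σ (c i l ⬝ᵥ ξ + d i l) := by
    intro i
    rw [hsol x y hy0 hx hy i, hx0, Fintype.sum_sigma,
      Finset.sum_eq_single i (fun j _ hj => by simp [hj]) (by simp)]
    simp
  have : NeZero m := ⟨hm.ne'⟩
  calc euclNorm (y T - F ξ) ≤ ∑ i, |(y T - F ξ) i| := euclNorm_le_sum_abs _
    _ < ∑ _i : Fin m, η / m := by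
        refine Finset.sum_lt_sum_of_nonempty Finset.univ_nonempty fun i _ => ?_
        rw [Pi.sub_apply, hy_T]
        exact happ i ξ hξ
    _ = η := by
        have : (m : ℝ) ≠ 0 := Nat.cast_ne_zero.mpr hm.ne'
        simp only [Finset.sum_const, Finset.card_univ, Fintype.card_fin, nsmul_eq_mul]
        field_simp
end

section
/- Let n, m, N, r ∈ ℕ, T > 0, Ω := C([0,T]; ℝ^r), let D ⊂ ℝ^n be compact, P ∈ ℝ^{m×N}, Q ∈ ℝ^{N×n}, and let f : [0,T] × ℝ^N × ℝ^r → ℝ^N be continuously differentiable with f(t, ·, ω(t)) Lipschitz continuous uniformly in t ∈ [0,T] for each ω ∈ Ω. Fix ξ ∈ D and F : D → ℝ^m, and for ω ∈ Ω let x[ω](·; ξ) solve x' = f(t, x, ω(t)) on (0,T] with x(0) = Qξ. Define Φ : Ω → ℝ by Φ[ω] = ½|P x[ω](T; ξ) − F(ξ)|², and let λ : [0,T] → ℝ^N solve the adjoint equation λ'(t) = −∇_x f^⊤(t, x[ω](t; ξ), ω(t)) λ(t) on [0,T) with λ(T) = P^⊤(P x[ω](T; ξ) − F(ξ)). Then Φ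 is Fréchet differentiable at ω and its derivative is represented by the L²(0,T; ℝ^r) inner product with G[ω] ∈ Ω given by G[ω](t) = ∇_ω f^⊤(t, x[ω](t; ξ), ω(t)) λ(t); that is, ∂Φ[ω]η = ∫_0^T G[ω](t) · η(t) dt for every η ∈ Ω. -/
open Matrix

/-- Extension of a continuous map on [0,T] to all of ℝ (constant outside [0,T]). -/
noncomputable def cext {T : ℝ} (hT : (0 : ℝ) ≤ T) {E : Type*} [TopologicalSpace E]
    (g : C(Set.Icc (0 : ℝ) T, E)) : ℝ → E :=
  Set.IccExtend hT ⇑g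

section

open Set Topology

/-- A `C¹` map is differentiable uniformly over a compact set. -/
lemma exists_norm_sub_sub_fderiv_le {E Y : Type*} [NormedAddCommGroup E] [NormedSpace ℝ E]
    [NormedAddCommGroup Y] [NormedSpace ℝ Y] {g : E → Y} (hg : ContDiff ℝ 1 g) {K : Set E}
    (hK : IsCompact K) {ε : ℝ} (hε : 0 < ε) :
    ∃ δ > 0, ∀ p ∈ K, ∀ h, ‖h‖ < δ → ‖g (p + h) - g p - fderiv ℝ g p h‖ ≤ ε * ‖h‖ := by
  have hc : Continuous (fderiv ℝ g) := hg.continuous_fderiv one_ne_zero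
  have hu := hK.uniformContinuousAt_of_continuousAt (fderiv ℝ g)
    (fun a _ => hc.continuousAt) (Metric.dist_mem_uniformity hε)
  obtain ⟨δ, hδ, H⟩ := Metric.mem_uniformity_dist.1 hu
  refine ⟨δ, hδ, fun p hp h hh => ?_⟩
  have key := (convex_ball p δ).norm_image_sub_le_of_norm_fderiv_le' (𝕜 := ℝ) (f := g)
    (φ := fderiv ℝ g p) (C := ε) (x := p) (y := p + h)
    (fun x _ => (hg.differentiable one_ne_zero) x) ?_ (Metric.mem_ball_self hδ) (by simpa using hh)
  · simpa using key
  · intro x hx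
    have := H (a := p) (b := x) (by rw [dist_comm]; exact hx) hp
    rw [← dist_eq_norm, dist_comm]
    exact le_of_lt this

/-- A `C¹` map is Lipschitz near a compact set, uniformly over base points in that set. -/
lemma exists_norm_sub_le {E Y : Type*} [NormedAddCommGroup E] [NormedSpace ℝ E]
    [NormedAddCommGroup Y] [NormedSpace ℝ Y] {g : E → Y} (hg : ContDiff ℝ 1 g) {K : Set E}
    (hK : IsCompact K) :
    ∃ L ≥ 0, ∃ δ > 0, ∀ p ∈ K, ∀ h, ‖h‖ < δ → ‖g (p + h) - g p‖ ≤ L * ‖h‖ := by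
  have hc : Continuous (fderiv ℝ g) := hg.continuous_fderiv one_ne_zero
  obtain ⟨C, hC⟩ := hK.exists_bound_of_continuousOn hc.continuousOn
  obtain ⟨δ, hδ, H⟩ := exists_norm_sub_sub_fderiv_le hg hK one_pos
  refine ⟨max C 0 + 1, by positivity, δ, hδ, fun p hp h hh => ?_⟩
  have h1 := H p hp h hh
  have h2 : ‖fderiv ℝ g p h‖ ≤ max C 0 * ‖h‖ :=
    (fderiv ℝ g p).le_of_opNorm_le ((hC p hp).trans (le_max_left _ _)) h
  have h3 := norm_add_le (g (p + h) - g p - fderiv ℝ g p h) (fderiv ℝ g p h)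
  rw [sub_add_cancel] at h3
  linarith

/-- A Grönwall bound in which the differential inequality is only known inside a ball. -/
lemma norm_le_of_norm_deriv_le_near_zero {X : Type*} [NormedAddCommGroup X] [NormedSpace ℝ X]
    {T L d ρ : ℝ} (hL : 0 ≤ L) (hd : 0 < d) (hρ : d * Real.exp ((2 * L + 1) * T) < ρ)
    {z z' : ℝ → X} (hz0 : z 0 = 0)
    (hz : ∀ t ∈ Icc 0 T, HasDerivWithinAt z (z' t) (Icc 0 T) t)
    (hz' : ∀ t ∈ Icc 0 T, ‖z t‖ < ρ → ‖z' t‖ ≤ L * (‖z t‖ + d)) :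
    ∀ t ∈ Icc 0 T, ‖z t‖ ≤ d * Real.exp ((2 * L + 1) * T) := by
  have hmono : ∀ t ≤ T, d * Real.exp ((2 * L + 1) * t) ≤ d * Real.exp ((2 * L + 1) * T) := by
    intro t ht
    gcongr
  have hB : ∀ t, HasDerivAt (fun t => d * Real.exp ((2 * L + 1) * t))
      ((2 * L + 1) * (d * Real.exp ((2 * L + 1) * t))) t := by
    intro t
    refine ((((hasDerivAt_id t).const_mul (2 * L + 1)).exp).const_mul d).congr_deriv ?_
    simp only [id, mul_one]
    ring
  have key := image_norm_le_of_norm_deriv_right_lt_deriv_boundary' (f := z) (f' := z')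
    (a := 0) (b := T) (fun t ht => (hz t ht).continuousWithinAt)
    (fun t ht => (hz t (Ico_subset_Icc_self ht)).mono_of_mem_nhdsWithin
      (Icc_mem_nhdsGE_of_mem ht))
    (B := fun t => d * Real.exp ((2 * L + 1) * t)) (by simp [hz0, hd.le])
    (fun t _ => (hB t).continuousAt.continuousWithinAt)
    (fun t _ => (hB t).hasDerivWithinAt) ?_
  · exact fun t ht => (key ht).trans (hmono t ht.2)
  · intro t ht hzt
    have hdB : d ≤ d * Real.exp ((2 * L + 1) * t) :=
      le_mul_of_one_le_right hd.le (Real.one_le_exp (mul_nonneg (by linarith) ht.1))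
    have h1 := hz' t (Ico_subset_Icc_self ht) (by rw [hzt]; exact (hmono t ht.2.le).trans_lt hρ)
    rw [hzt] at h1
    nlinarith

lemma abs_dotProduct_le {k : ℕ} (v w : Fin k → ℝ) : |v ⬝ᵥ w| ≤ k * (‖v‖ * ‖w‖) := by
  calc |v ⬝ᵥ w| ≤ ∑ i, |v i * w i| := Finset.abs_sum_le_sum_abs _ _
    _ ≤ ∑ _i : Fin k, ‖v‖ * ‖w‖ := by
        gcongr with i
        rw [abs_mul]
        exact mul_le_mul (norm_le_pi_norm v i) (norm_le_pi_norm w i) (abs_nonneg _) (norm_nonneg _)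
    _ = k * (‖v‖ * ‖w‖) := by simp

lemma HasDerivWithinAt.dotProduct {k : ℕ} {u v : ℝ → Fin k → ℝ} {u' v' : Fin k → ℝ} {s : Set ℝ}
    {t : ℝ} (hu : HasDerivWithinAt u u' s t) (hv : HasDerivWithinAt v v' s t) :
    HasDerivWithinAt (fun t => u t ⬝ᵥ v t) (u' ⬝ᵥ v t + u t ⬝ᵥ v') s t := by
  rw [hasDerivWithinAt_pi] at hu hv
  have := HasDerivWithinAt.fun_sum (u := Finset.univ) fun i _ => (hu i).mul (hv i)
  simpa [_root_.dotProduct, Finset.sum_add_distrib] using this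

/-- Integration of a continuous family of functionals against continuous paths on `[0, T]`. -/
lemma exists_clm_integral {T : ℝ} (hT : 0 ≤ T) {W : Type*} [NormedAddCommGroup W]
    [NormedSpace ℝ W] {ψ : ℝ → W →L[ℝ] ℝ} (hψ : ContinuousOn ψ (Icc 0 T)) :
    ∃ Ψ : C(Icc (0 : ℝ) T, W) →L[ℝ] ℝ,
      ∀ η, Ψ η = ∫ t in (0 : ℝ)..T, ψ t (cext hT η t) := by
  obtain ⟨C, hC⟩ := isCompact_Icc.exists_bound_of_continuousOn hψ
  have hI : ∀ η : C(Icc (0 : ℝ) T, W),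
      IntervalIntegrable (fun t => ψ t (cext hT η t)) MeasureTheory.volume 0 T := by
    intro η
    refine ContinuousOn.intervalIntegrable ?_
    rw [uIcc_of_le hT]
    exact hψ.clm_apply (η.continuous.Icc_extend' (h := hT)).continuousOn
  refine ⟨LinearMap.mkContinuous
    { toFun := fun η => ∫ t in (0 : ℝ)..T, ψ t (cext hT η t)
      map_add' := fun η θ => ?_
      map_smul' := fun c η => ?_ } (C * |T - 0|) fun η => ?_, fun η => rfl⟩
  · rw [← intervalIntegral.integral_add (hI η) (hI θ)]
    simp [cext, IccExtend]
  · simp [cext, IccExtend]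
  · have := intervalIntegral.norm_integral_le_of_norm_le_const (a := 0) (b := T)
      (f := fun t => ψ t (cext hT η t)) (C := C * ‖η‖) ?_
    · simpa [mul_right_comm] using this
    · intro t ht
      rw [uIoc_of_le hT] at ht
      exact (ψ t).le_of_opNorm_le_of_le (hC t (Ioc_subset_Icc_self ht)) (η.norm_coe_le_norm _)

/-- Along an adjoint solution `lam` of the linear part of the equation for `z`, the pairing
`lam ⬝ᵥ z` is the integral of the source term, up to the integrated residual. -/
lemma abs_dotProduct_sub_integral_le {T C : ℝ} (hT : 0 ≤ T) {N : ℕ} {lam z z' : ℝ → Fin N → ℝ}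
    {A : ℝ → (Fin N → ℝ) →L[ℝ] (Fin N → ℝ)} {b : ℝ → ℝ} (hb : ContinuousOn b (Icc 0 T))
    (hz0 : z 0 = 0) (hz : ∀ t ∈ Icc 0 T, HasDerivWithinAt z (z' t) (Icc 0 T) t)
    (hlam : ∀ t ∈ Icc 0 T,
      HasDerivWithinAt lam (fun j => -(lam t ⬝ᵥ A t (Pi.single j 1))) (Icc 0 T) t)
    (hC : ∀ t ∈ Icc 0 T, |lam t ⬝ᵥ (z' t - A t (z t)) - b t| ≤ C) :
    |lam T ⬝ᵥ z T - ∫ t in (0 : ℝ)..T, b t| ≤ C * T := by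
  have hA : ∀ t, (fun j => -(lam t ⬝ᵥ A t (Pi.single j 1))) ⬝ᵥ z t = -(lam t ⬝ᵥ A t (z t)) := by
    intro t
    have h1 : z t = ∑ j, z t j • (Pi.single j 1 : Fin N → ℝ) := pi_eq_sum_univ' (z t)
    conv_rhs => rw [h1, map_sum, dotProduct_sum]
    rw [dotProduct, ← Finset.sum_neg_distrib]
    refine Finset.sum_congr rfl fun j _ => ?_
    rw [map_smul, dotProduct_smul, smul_eq_mul]
    ring
  have hderiv : ∀ t ∈ Icc 0 T, HasDerivWithinAt (fun t => lam t ⬝ᵥ z t - ∫ s in (0 : ℝ)..t, b s)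
      (lam t ⬝ᵥ (z' t - A t (z t)) - b t) (Icc 0 T) t := by
    intro t ht
    have hI : HasDerivWithinAt (fun u => ∫ s in (0 : ℝ)..u, b s) (b t) (Icc 0 T) t := by
      have : Fact (t ∈ Icc 0 T) := ⟨ht⟩
      refine intervalIntegral.integral_hasDerivWithinAt_right ?_
        (hb.stronglyMeasurableAtFilter_nhdsWithin measurableSet_Icc t) (hb t ht)
      refine (hb.mono ?_).intervalIntegrable
      rw [uIcc_of_le ht.1]
      exact Icc_subset_Icc_right ht.2
    refine (((hlam t ht).dotProduct (hz t ht)).fun_sub hI).congr_deriv ?_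
    rw [hA, dotProduct_sub]
    ring
  have key := norm_image_sub_le_of_norm_deriv_le_segment' hderiv
    (fun t ht => hC t (Ico_subset_Icc_self ht)) T (right_mem_Icc.2 hT)
  simpa [hz0] using key

/-- Remainder of the quadratic loss `½|y|²` around `p`. -/
lemma abs_sq_loss_sub_le {m : ℕ} (p v : Fin m → ℝ) :
    |(1 / 2 : ℝ) * ∑ i, (p i + v i) ^ 2 - (1 / 2 : ℝ) * ∑ i, p i ^ 2 - p ⬝ᵥ v| ≤ m * ‖v‖ ^ 2 := by
  have h : (1 / 2 : ℝ) * ∑ i, (p i + v i) ^ 2 - (1 / 2 : ℝ) * ∑ i, p i ^ 2 - p ⬝ᵥ v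
      = (1 / 2) * (v ⬝ᵥ v) := by
    simp only [dotProduct, Finset.mul_sum, ← Finset.sum_sub_distrib]
    exact Finset.sum_congr rfl fun i _ => by ring
  rw [h, abs_mul]
  have h1 := abs_dotProduct_le v v
  have h2 := abs_nonneg (v ⬝ᵥ v)
  rw [abs_of_pos (by norm_num : (0 : ℝ) < 1 / 2), sq]
  linarith

end

/-- Theorem: the gradient of the loss Φ[ω] = ½|Px[ω](T;ξ) − F(ξ)|² with
respect to the design parameter ω, represented through the adjoint state λ:
∂Φ[ω]η = ∫₀ᵀ (∇_ω f)ᵀλ(t) · η(t) dt. -/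
theorem stmt_10 (n m N r : ℕ) (T : ℝ) (hT : 0 < T)
    (D : Set (Fin n → ℝ)) (hD : IsCompact D)
    (P : Matrix (Fin m) (Fin N) ℝ) (Q : Matrix (Fin N) (Fin n) ℝ)
    (f : ℝ → (Fin N → ℝ) → (Fin r → ℝ) → (Fin N → ℝ))
    (hf : ContDiff ℝ 1 fun p : ℝ × (Fin N → ℝ) × (Fin r → ℝ) => f p.1 p.2.1 p.2.2)
    (hLip : ∀ w : Fin r → ℝ, ∃ L > 0, ∀ t ∈ Set.Icc (0 : ℝ) T, ∀ x₁ x₂ : Fin N → ℝ,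
      euclNorm (f t x₁ w - f t x₂ w) ≤ L * euclNorm (x₁ - x₂))
    (ξ : Fin n → ℝ) (hξ : ξ ∈ D) (F : (Fin n → ℝ) → Fin m → ℝ)
    (xsol : C(Set.Icc (0 : ℝ) T, Fin r → ℝ) → ℝ → Fin N → ℝ)
    (hx0 : ∀ ω, xsol ω 0 = Q.mulVec ξ)
    (hxsol : ∀ ω, ∀ t ∈ Set.Icc (0 : ℝ) T,
      HasDerivWithinAt (xsol ω) (f t (xsol ω t) (cext hT.le ω t)) (Set.Icc 0 T) t)
    (ω : C(Set.Icc (0 : ℝ) T, Fin r → ℝ))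
    (lam : ℝ → Fin N → ℝ)
    (hlamT : lam T = Pᵀ.mulVec (P.mulVec (xsol ω T) - F ξ))
    (hlam : ∀ t ∈ Set.Icc (0 : ℝ) T,
      HasDerivWithinAt lam
        (fun j => -∑ i, lam t i *
          fderiv ℝ (fun z => f t z (cext hT.le ω t) i) (xsol ω t) (Pi.single j 1))
        (Set.Icc 0 T) t) :
    ∃ DΦ : C(Set.Icc (0 : ℝ) T, Fin r → ℝ) →L[ℝ] ℝ,
      HasFDerivAt (fun ω' => (1 / 2 : ℝ) * ∑ i, (P.mulVec (xsol ω' T) i - F ξ i) ^ 2)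
        DΦ ω ∧
      ∀ η : C(Set.Icc (0 : ℝ) T, Fin r → ℝ),
        DΦ η = ∫ t in (0 : ℝ)..T, ∑ i, lam t i *
          fderiv ℝ (fun w => f t (xsol ω t) w i) (cext hT.le ω t) (cext hT.le η t) := by
  set g : ℝ × (Fin N → ℝ) × (Fin r → ℝ) → (Fin N → ℝ) := fun p => f p.1 p.2.1 p.2.2 with hg
  set w : ℝ → Fin r → ℝ := cext hT.le ω with hw
  set x : ℝ → Fin N → ℝ := xsol ω with hx
  set γ : ℝ → ℝ × (Fin N → ℝ) × (Fin r → ℝ) := fun t => (t, x t, w t) with hγ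
  have hxc : ContinuousOn x (Set.Icc 0 T) := fun t ht => (hxsol ω t ht).continuousWithinAt
  have hwc : Continuous w := ω.continuous.Icc_extend'
  have hlc : ContinuousOn lam (Set.Icc 0 T) := fun t ht => (hlam t ht).continuousWithinAt
  have hγc : ContinuousOn γ (Set.Icc 0 T) :=
    continuousOn_id.prodMk (hxc.prodMk hwc.continuousOn)
  have hK : IsCompact (γ '' Set.Icc 0 T) := isCompact_Icc.image_of_continuousOn hγc
  have hgd : Differentiable ℝ g := hf.differentiable one_ne_zero
  have hAi : ∀ t i v, fderiv ℝ (fun z => f t z (w t) i) (x t) v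
      = fderiv ℝ g (γ t) (0, v, 0) i := by
    intro t i v
    have h1 : HasFDerivAt (fun z : Fin N → ℝ => (t, z, w t))
        ((0 : (Fin N → ℝ) →L[ℝ] ℝ).prod ((ContinuousLinearMap.id ℝ _).prod 0)) (x t) :=
      (hasFDerivAt_const t _).prodMk ((hasFDerivAt_id _).prodMk (hasFDerivAt_const _ _))
    have h2 := hasFDerivAt_pi'.1 ((hgd (γ t)).hasFDerivAt.comp (x t) h1) i
    rw [HasFDerivAt.fderiv (f := fun z => f t z (w t) i) h2]
    simp
  have hBi : ∀ t i v, fderiv ℝ (fun u => f t (x t) u i) (w t) v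
      = fderiv ℝ g (γ t) (0, 0, v) i := by
    intro t i v
    have h1 : HasFDerivAt (fun u : Fin r → ℝ => (t, x t, u))
        ((0 : (Fin r → ℝ) →L[ℝ] ℝ).prod
          ((0 : (Fin r → ℝ) →L[ℝ] (Fin N → ℝ)).prod (ContinuousLinearMap.id ℝ _))) (w t) :=
      (hasFDerivAt_const t _).prodMk ((hasFDerivAt_const _ _).prodMk (hasFDerivAt_id _))
    have h2 := hasFDerivAt_pi'.1 ((hgd (γ t)).hasFDerivAt.comp (w t) h1) i
    rw [HasFDerivAt.fderiv (f := fun u => f t (x t) u i) h2]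
    simp
  set A : ℝ → (Fin N → ℝ) →L[ℝ] (Fin N → ℝ) := fun t =>
    (fderiv ℝ g (γ t)).comp
      ((ContinuousLinearMap.inr ℝ ℝ ((Fin N → ℝ) × (Fin r → ℝ))).comp
        (ContinuousLinearMap.inl ℝ (Fin N → ℝ) (Fin r → ℝ))) with hA
  set B : ℝ → (Fin r → ℝ) →L[ℝ] (Fin N → ℝ) := fun t =>
    (fderiv ℝ g (γ t)).comp
      ((ContinuousLinearMap.inr ℝ ℝ ((Fin N → ℝ) × (Fin r → ℝ))).comp
        (ContinuousLinearMap.inr ℝ (Fin N → ℝ) (Fin r → ℝ))) with hB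
  set ψ : ℝ → (Fin r → ℝ) →L[ℝ] ℝ := fun t =>
    ∑ i, lam t i •
      (ContinuousLinearMap.proj (R := ℝ) (φ := fun _ : Fin N => ℝ) i).comp (B t) with hψ
  have hψv : ∀ t v, ψ t v = lam t ⬝ᵥ B t v := by
    intro t v
    simp [hψ, dotProduct]
  have hBc : ContinuousOn B (Set.Icc 0 T) :=
    ((hf.continuous_fderiv one_ne_zero).comp_continuousOn hγc).clm_comp continuousOn_const
  have hψc : ContinuousOn ψ (Set.Icc 0 T) := by
    refine continuousOn_finsetSum _ fun i _ => ?_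
    exact ((continuous_apply i).comp_continuousOn hlc).smul (continuousOn_const.clm_comp hBc)
  obtain ⟨Ψ, hΨ⟩ := exists_clm_integral hT.le hψc
  refine ⟨Ψ, ?_, fun η => ?_⟩
  swap
  · rw [hΨ]
    refine intervalIntegral.integral_congr fun t _ => ?_
    simp only [hψv, hBi]
    rfl
  obtain ⟨Λ, hΛ⟩ := isCompact_Icc.exists_bound_of_continuousOn hlc
  have hΛ0 : 0 ≤ Λ := (norm_nonneg _).trans (hΛ 0 (Set.left_mem_Icc.2 hT.le))
  obtain ⟨L, hL, ρ, hρ, hLip'⟩ := exists_norm_sub_le hf hK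
  set M : ℝ := Real.exp ((2 * L + 1) * T) with hM
  have hM1 : 1 ≤ M := Real.one_le_exp (by positivity)
  set PL : (Fin N → ℝ) →L[ℝ] (Fin m → ℝ) := LinearMap.toContinuousLinearMap P.mulVecLin with hPL
  rw [hasFDerivAt_iff_isLittleO_nhds_zero, Asymptotics.isLittleO_iff]
  intro c hc
  set ε : ℝ := c / (2 * (N * Λ * M * T + 1)) with hε
  have hε0 : 0 < ε := by positivity
  obtain ⟨δ, hδ, hdiff⟩ := exists_norm_sub_sub_fderiv_le hf hK hε0
  set κ : ℝ := m * (‖PL‖ * M) ^ 2 with hκ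
  have hκ0 : 0 ≤ κ := by positivity
  have hτ : 0 < min (min (ρ / M) (δ / M)) (c / (2 * (κ + 1))) := by positivity
  filter_upwards [Metric.ball_mem_nhds (0 : C(Set.Icc (0 : ℝ) T, Fin r → ℝ)) hτ] with η hη
  rcases eq_or_ne η 0 with rfl | hη0
  · simp
  have hηpos : 0 < ‖η‖ := norm_pos_iff.2 hη0
  rw [mem_ball_zero_iff, lt_min_iff, lt_min_iff, lt_div_iff₀ (by positivity),
    lt_div_iff₀ (by positivity), lt_div_iff₀ (by positivity)] at hη
  obtain ⟨⟨hη1, hη2⟩, hη3⟩ := hη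
  set h : ℝ → Fin r → ℝ := cext hT.le η with hh
  have hhle : ∀ t, ‖h t‖ ≤ ‖η‖ := fun t => η.norm_coe_le_norm _
  set z : ℝ → Fin N → ℝ := fun t => xsol (ω + η) t - x t with hz
  have hz0 : z 0 = 0 := by simp [hz, hx, hx0]
  have hzd : ∀ t ∈ Set.Icc 0 T,
      HasDerivWithinAt z (g (γ t + (0, z t, h t)) - g (γ t)) (Set.Icc 0 T) t := by
    intro t ht
    refine ((hxsol (ω + η) t ht).fun_sub (hxsol ω t ht)).congr_deriv ?_
    simp [hg, hγ, hz, hh, hw, hx, cext, Set.IccExtend]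
  have hnorm : ∀ t, ‖((0 : ℝ), z t, h t)‖ = max ‖z t‖ ‖h t‖ := by
    intro t
    simp [Prod.norm_def]
  have hηM : ‖η‖ ≤ ‖η‖ * M := le_mul_of_one_le_right hηpos.le hM1
  have hzle : ∀ t ∈ Set.Icc 0 T, ‖z t‖ ≤ ‖η‖ * M := by
    refine norm_le_of_norm_deriv_le_near_zero hL hηpos hη1 hz0 hzd fun t ht hzt => ?_
    have hp : ‖((0 : ℝ), z t, h t)‖ < ρ := by
      rw [hnorm]
      exact max_lt hzt ((hhle t).trans_lt (hηM.trans_lt hη1))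
    refine (hLip' _ (Set.mem_image_of_mem γ ht) _ hp).trans ?_
    rw [hnorm]
    gcongr
    exact max_le (by linarith) (by linarith [hhle t, norm_nonneg (z t)])
  have hple : ∀ t ∈ Set.Icc 0 T, ‖((0 : ℝ), z t, h t)‖ ≤ ‖η‖ * M := fun t ht => by
    rw [hnorm]
    exact max_le (hzle t ht) ((hhle t).trans hηM)
  have hpair : |lam T ⬝ᵥ z T - ∫ t in (0 : ℝ)..T, ψ t (h t)|
      ≤ N * (Λ * (ε * (‖η‖ * M))) * T := by
    refine abs_dotProduct_sub_integral_le hT.le (A := A)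
      (hψc.clm_apply (η.continuous.Icc_extend' (h := hT.le)).continuousOn) hz0 hzd ?_ ?_
    · intro t ht
      refine (hlam t ht).congr_deriv ?_
      simp only [hAi]
      rfl
    · intro t ht
      have h1 := (hdiff _ (Set.mem_image_of_mem γ ht) _ ((hple t ht).trans_lt hη2)).trans
        (mul_le_mul_of_nonneg_left (hple t ht) hε0.le)
      have h2 : fderiv ℝ g (γ t) (0, z t, h t) = A t (z t) + B t (h t) := by
        simp [hA, hB, ← map_add]
      rw [hψv, ← dotProduct_sub, sub_sub, ← h2]
      refine (abs_dotProduct_le _ _).trans ?_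
      gcongr
      exact hΛ t ht
  have hloss := abs_sq_loss_sub_le (P *ᵥ x T - F ξ) (P *ᵥ z T)
  have hPz : ‖P *ᵥ z T‖ ≤ ‖PL‖ * (‖η‖ * M) :=
    PL.le_opNorm_of_le (hzle T (Set.right_mem_Icc.2 hT.le))
  have hsum : ∀ i, (P *ᵥ x T - F ξ) i + (P *ᵥ z T) i = (P *ᵥ xsol (ω + η) T) i - F ξ i := by
    intro i
    simp [hz, mulVec_sub]
  have hadj : (P *ᵥ x T - F ξ) ⬝ᵥ (P *ᵥ z T) = lam T ⬝ᵥ z T := by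
    rw [hlamT, mulVec_transpose, ← dotProduct_mulVec]
  simp only [hsum, hadj] at hloss
  simp only [Pi.sub_apply] at hloss
  have hquad : (m : ℝ) * ‖P *ᵥ z T‖ ^ 2 ≤ c / 2 * ‖η‖ := by
    calc (m : ℝ) * ‖P *ᵥ z T‖ ^ 2 ≤ m * (‖PL‖ * (‖η‖ * M)) ^ 2 := by gcongr
      _ = κ * ‖η‖ * ‖η‖ := by rw [hκ]; ring
      _ ≤ c / 2 * ‖η‖ := by
        gcongr
        nlinarith
  have hlin : N * (Λ * (ε * (‖η‖ * M))) * T ≤ c / 2 * ‖η‖ := by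
    have h1 : ε * (2 * (N * Λ * M * T + 1)) = c := div_mul_cancel₀ _ (by positivity)
    calc N * (Λ * (ε * (‖η‖ * M))) * T = ε * (N * Λ * M * T) * ‖η‖ := by ring
      _ ≤ c / 2 * ‖η‖ := by
        gcongr
        linarith
  rw [hΨ, Real.norm_eq_abs]
  rw [abs_le] at hloss hpair ⊢
  constructor <;> linarith [hloss.1, hloss.2, hpair.1, hpair.2]
end
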